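/- (1) Let d > 2 and let q ≥ d be a prime. If the full linear matroid over F_q^d satisfies the α-partition property, then α ≤ (1.299/(1 − 1/e)) · 3/(d · (1 − q^{−d})); in particular α = O(1/d). (2) Let d > 2. If the full binary matroid over F_2^d satisfies the α-partition property, then α ≤ (1.299/(1 − 1/e)) · (3 + log₂ d)/(d · (1 − 2^{−d})); in particular α = O((log d)/d). -/

import Mathlib

open scoped ENNReal

/-- A simple partition datum for an independence system `Indep` on a finite ground
type: a finite family of pairwise disjoint nonempty parts such that every
transversal (a set contained in the union of the parts meeting each part at most
once) is independent. -/
def IsPartitionDatum {γ : Type*} [DecidableEq γ] (Indep : Finset γ → Prop)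
    (P : Finset (Finset γ)) : Prop :=
  (∀ p ∈ P, p.Nonempty) ∧
  (∀ p ∈ P, ∀ q ∈ P, p ≠ q → Disjoint p q) ∧
  (∀ T : Finset γ, (∀ x ∈ T, ∃ p ∈ P, x ∈ p) → (∀ p ∈ P, (T ∩ p).card ≤ 1) → Indep T)

/-- The weighted rank of a simple partition datum: the sum over parts of the maximum
weight in the part. -/
noncomputable def partitionWRank {γ : Type*} (P : Finset (Finset γ)) (w : γ → ℝ) : ℝ :=
  ∑ p ∈ P, sSup (w '' ↑p)

/-- The weighted rank `Rank_w = max{∑_{e∈T} w e : T independent}` of an independence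
system. -/
noncomputable def maxIndepWeight {γ : Type*} (Indep : Finset γ → Prop) (w : γ → ℝ) : ℝ :=
  sSup {x : ℝ | ∃ T : Finset γ, Indep T ∧ ∑ e ∈ T, w e = x}

/-- The `α`-partition property: there is a probability distribution over simple
partition data whose expected weighted rank is at least `α` times the weighted rank,
for every nonnegative weight function. -/
def HasPartitionProperty {γ : Type*} [DecidableEq γ] (Indep : Finset γ → Prop)
    (α : ℝ) : Prop :=
  ∃ D : PMF {P : Finset (Finset γ) // IsPartitionDatum Indep P},
    ∀ w : γ → ℝ, (∀ e, 0 ≤ w e) →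
      ENNReal.ofReal (α * maxIndepWeight Indep w)
        ≤ ∑' P, D P * ENNReal.ofReal (partitionWRank (↑P) w)

section FiniteLinearAlgebra

open Finset

/-- A surjective homomorphism of finite groups sends the uniform distribution to the uniform
distribution. -/
lemma card_preimage_mul_card {G M : Type*} [AddCommGroup G] [Fintype G] [AddCommGroup M]
    [Fintype M] [DecidableEq M] (f : G →+ M) (hf : Function.Surjective f) (A : Finset M) :
    #{g | f g ∈ A} * Fintype.card M = #A * Fintype.card G := by
  have hfib : ∀ x, #{g | f g = x} = #{g | f g = 0} := fun x =>
    AddMonoidHom.card_fiber_eq_of_mem_range f (hf x) (hf 0)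
  have hpre : ∀ B : Finset M, #{g | f g ∈ B} = #B * #{g | f g = 0} := by
    intro B
    rw [card_eq_sum_card_fiberwise (f := f) (t := B) (fun g hg => by simpa using hg)]
    rw [sum_congr rfl (g := fun _ => #{g | f g = 0}), sum_const, smul_eq_mul]
    intro x hx
    rw [← hfib x, filter_filter]
    congr 1
    ext g
    simp only [mem_filter, mem_univ, true_and]
    exact ⟨fun h => h.2, fun h => ⟨h ▸ hx, h⟩⟩
  have huniv := hpre univ
  simp only [mem_univ, filter_true, card_univ] at huniv
  rw [hpre, huniv]
  ring

variable {K V : Type*} [Field K] [AddCommGroup V] [Module K V]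

lemma exists_linearEquiv_apply_eq_of_ne_zero {x y : V} (hx : x ≠ 0) (hy : y ≠ 0) :
    ∃ g : V ≃ₗ[K] V, g x = y := by
  obtain ⟨g, hg⟩ := Submodule.exists_linearEquiv_restrict_eq
    ((LinearEquiv.toSpanNonzeroSingleton K V x hx).symm ≪≫ₗ
      LinearEquiv.toSpanNonzeroSingleton K V y hy)
  refine ⟨g, ?_⟩
  have h := hg ⟨x, Submodule.mem_span_singleton_self x⟩
  have h1 : (⟨x, Submodule.mem_span_singleton_self x⟩ : Submodule.span K {x})
      = LinearEquiv.toSpanNonzeroSingleton K V x hx 1 := by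
    ext; simp
  rw [LinearEquiv.trans_apply, h1, LinearEquiv.symm_apply_apply] at h
  simpa using h.symm

/-- A uniformly random linear automorphism sends a fixed nonzero vector to a uniformly random
nonzero vector. -/
lemma card_linearEquiv_apply_mem [Fintype V] [DecidableEq V] [Fintype (V ≃ₗ[K] V)]
    {v : V} (hv : v ≠ 0) {A : Finset V} (hA : (0 : V) ∉ A) :
    #{g : V ≃ₗ[K] V | g v ∈ A} * (Fintype.card V - 1) = #A * Fintype.card (V ≃ₗ[K] V) := by
  have hconst : ∀ u ∈ (univ : Finset V).erase 0,
      #{g : V ≃ₗ[K] V | g u ∈ A} = #{g : V ≃ₗ[K] V | g v ∈ A} := by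
    intro u hu
    obtain ⟨h, rfl⟩ := exists_linearEquiv_apply_eq_of_ne_zero (K := K) hv (ne_of_mem_erase hu)
    refine card_bij (fun g _ => g * h) ?_ ?_ ?_
    · intro g hg
      simpa using hg
    · intro a _ b _ hab
      exact mul_right_cancel hab
    · intro g hg
      refine ⟨g * h⁻¹, mem_filter.2 ⟨mem_univ _, ?_⟩, by simp⟩
      have hinv : h⁻¹ (h v) = v := h.symm_apply_apply v
      rw [LinearEquiv.mul_apply, hinv]
      exact (mem_filter.1 hg).2
  have hsum : ∑ u ∈ (univ : Finset V).erase 0, #{g : V ≃ₗ[K] V | g u ∈ A}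
      = (Fintype.card V - 1) * #{g : V ≃ₗ[K] V | g v ∈ A} := by
    rw [sum_congr rfl hconst, sum_const, card_erase_of_mem (mem_univ _), card_univ, smul_eq_mul]
  have hswap : ∑ u ∈ (univ : Finset V).erase 0, #{g : V ≃ₗ[K] V | g u ∈ A}
      = ∑ g : V ≃ₗ[K] V, #{u ∈ (univ : Finset V).erase 0 | g u ∈ A} := by
    simp only [card_filter]
    exact sum_comm
  have hcard : ∀ g : V ≃ₗ[K] V, #{u ∈ (univ : Finset V).erase 0 | g u ∈ A} = #A := by
    intro g
    refine card_bij (fun u _ => g u) ?_ ?_ ?_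
    · intro u hu
      exact (mem_filter.1 hu).2
    · intro a _ b _ hab
      exact g.injective hab
    · intro a ha
      refine ⟨g.symm a, ?_, by simp⟩
      simp only [mem_filter, mem_erase, mem_univ, and_true, LinearEquiv.apply_symm_apply]
      refine ⟨?_, ha⟩
      intro h0
      have : a = 0 := by simpa using h0
      exact hA (this ▸ ha)
  rw [hswap, sum_congr rfl (fun g _ => hcard g), sum_const, card_univ, smul_eq_mul] at hsum
  rw [mul_comm, ← hsum, mul_comm]

/-- The point with coordinates `c` of the affine subspace spanned by `x + y i`, as a linear
function of the pair `(x, y)`. -/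
def affinePoint {s : ℕ} (c : Fin s → K) : (V × (Fin s → V)) →ₗ[K] V :=
  LinearMap.fst K V (Fin s → V) +
    ∑ i, c i • (LinearMap.proj i ∘ₗ LinearMap.snd K V (Fin s → V))

lemma affinePoint_apply {s : ℕ} (c : Fin s → K) (ω : V × (Fin s → V)) :
    affinePoint c ω = ω.1 + ∑ i, c i • ω.2 i := by
  simp [affinePoint]

lemma affinePoint_surjective {s : ℕ} (c : Fin s → K) :
    Function.Surjective (affinePoint (V := V) c) := fun v =>
  ⟨(v, 0), by simp [affinePoint_apply]⟩

lemma affinePoint_prod_surjective {s : ℕ} {c c' : Fin s → K} (h : c ≠ c') :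
    Function.Surjective ((affinePoint (V := V) c).prod (affinePoint c')) := by
  rintro ⟨u, v⟩
  obtain ⟨i, hi⟩ := Function.ne_iff.1 h
  have hi' : c i - c' i ≠ 0 := sub_ne_zero.2 hi
  have hsum : ∀ (a : Fin s → K) (z : V),
      ∑ j, a j • (Pi.single i z : Fin s → V) j = a i • z := by
    intro a z
    rw [sum_eq_single i]
    · simp
    · intro j _ hj
      simp [hj]
    · simp
  refine ⟨(u - c i • (c i - c' i)⁻¹ • (u - v), Pi.single i ((c i - c' i)⁻¹ • (u - v))), ?_⟩
  simp only [LinearMap.prod_apply, Function.prod_apply, affinePoint_apply, hsum, Prod.mk.injEq]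
  refine ⟨by abel, ?_⟩
  have : (c i - c' i) • (c i - c' i)⁻¹ • (u - v) = u - v := smul_inv_smul₀ hi' _
  rw [sub_smul] at this
  have h2 : u - v = c i • (c i - c' i)⁻¹ • (u - v) - c' i • (c i - c' i)⁻¹ • (u - v) := this.symm
  generalize c i • (c i - c' i)⁻¹ • (u - v) = a at *
  generalize c' i • (c i - c' i)⁻¹ • (u - v) = b at *
  have : u - a + b - v = 0 := by
    rw [show u - a + b - v = (u - v) - (a - b) by abel, h2]; abel
  exact sub_eq_zero.1 this

lemma IsPartitionDatum.zero_notMem [DecidableEq V] {P : Finset (Finset V)}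
    (hP : IsPartitionDatum (fun T : Finset V =>
      LinearIndependent K (Subtype.val : {x // x ∈ T} → V)) P) {p : Finset V} (hp : p ∈ P) :
    (0 : V) ∉ p := by
  intro h0
  have h := hP.2.2 {0} (by simpa using ⟨p, hp, h0⟩)
    (fun q _ => (card_le_card inter_subset_left).trans (by simp))
  exact h.ne_zero ⟨0, by simp⟩ rfl

/-- At most `m` parts of a partition of a linear matroid meet the span of `m` vectors. -/
lemma IsPartitionDatum.card_parts_meeting_span_le [Fintype V] [DecidableEq V] {P : Finset (Finset V)}
    (hP : IsPartitionDatum (fun T : Finset V =>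
      LinearIndependent K (Subtype.val : {x // x ∈ T} → V)) P)
    {ι : Type*} [Fintype ι] (b : ι → V) {Q : Finset (Finset V)} (hQP : Q ⊆ P)
    (hQ : ∀ p ∈ Q, ∃ v ∈ p, v ∈ Submodule.span K (Set.range b)) :
    #Q ≤ Fintype.card ι := by
  obtain ⟨-, hdisj, hind⟩ := hP
  have hQ' : ∀ p : Finset V, ∃ v, p ∈ Q → v ∈ p ∧ v ∈ Submodule.span K (Set.range b) := by
    intro p
    by_cases hp : p ∈ Q
    · obtain ⟨v, hv⟩ := hQ p hp
      exact ⟨v, fun _ => hv⟩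
    · exact ⟨0, fun h => absurd h hp⟩
  choose t ht using hQ'
  have huniq : ∀ p ∈ Q, ∀ q ∈ P, t p ∈ q → p = q := by
    intro p hp q hq hmem
    by_contra hne
    exact Finset.disjoint_left.1 (hdisj p (hQP hp) q hq hne) (ht p hp).1 hmem
  have hinj : Set.InjOn t Q := by
    intro p hp q hq hpq
    exact huniq p hp q (hQP hq) (hpq ▸ (ht q hq).1)
  have hT := hind (Q.image t)
    (by
      intro x hx
      obtain ⟨p, hp, rfl⟩ := mem_image.1 hx
      exact ⟨p, hQP hp, (ht p hp).1⟩)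
    (by
      intro q hq
      refine card_le_one.2 ?_
      intro x hx y hy
      obtain ⟨hx1, hx2⟩ := mem_inter.1 hx
      obtain ⟨hy1, hy2⟩ := mem_inter.1 hy
      obtain ⟨p, hp, rfl⟩ := mem_image.1 hx1
      obtain ⟨p', hp', rfl⟩ := mem_image.1 hy1
      rw [huniq p hp q hq hx2, huniq p' hp' q hq hy2])
  have hle : Submodule.span K (Set.range (Subtype.val : {x // x ∈ Q.image t} → V)) ≤
      Submodule.span K (Set.range b) := by
    rw [Submodule.span_le]
    rintro _ ⟨⟨x, hx⟩, rfl⟩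
    obtain ⟨p, hp, rfl⟩ := mem_image.1 hx
    exact (ht p hp).2
  have hfin := Submodule.finrank_mono hle
  rw [finrank_span_eq_card hT, Fintype.card_coe, card_image_of_injOn hinj] at hfin
  exact hfin.trans (finrank_range_le_card b)

lemma card_le_maxIndepWeight_of_basis [Fintype V] [DecidableEq V] {d : ℕ} (b : Module.Basis (Fin d) K V) :
    (d : ℝ) ≤ maxIndepWeight (fun T : Finset V =>
      LinearIndependent K (Subtype.val : {x // x ∈ T} → V))
      (fun v => if ∃ j, b j = v then 1 else 0) := by
  refine le_csSup ⟨∑ v : V, if ∃ j, b j = v then (1 : ℝ) else 0, ?_⟩ ⟨univ.image b, ?_, ?_⟩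
  · rintro _ ⟨T, -, rfl⟩
    exact sum_le_sum_of_subset_of_nonneg (subset_univ T)
      fun v _ _ => by split_ifs <;> norm_num
  · have h := b.linearIndependent.linearIndepOn_id
    have hset : ((univ.image b : Finset V) : Set V) = Set.range b := by simp
    rw [← hset] at h
    exact h
  · rw [sum_image (fun i _ j _ h => b.injective h)]
    simp

variable [Fintype K] [Fintype V] [DecidableEq V]

/-- Second-moment estimate: a random affine subspace of dimension at most `s` meets `A` with
probability at least half of `min 1 (|K| ^ s * |A| / |V|)`. -/
lemma min_mul_card_le_two_mul_card_affine_hits (s : ℕ) (A : Finset V) :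
    min 1 ((Fintype.card K : ℝ) ^ s * #A / Fintype.card V) * Fintype.card (V × (Fin s → V)) ≤
      2 * #{ω : V × (Fin s → V) | ∃ c : Fin s → K, affinePoint c ω ∈ A} := by
  classical
  set N : ℝ := (Fintype.card V : ℝ) with hN
  set W : ℝ := (Fintype.card (V × (Fin s → V)) : ℝ) with hW
  set C : ℝ := (Fintype.card K : ℝ) ^ s with hC
  set H : Finset (V × (Fin s → V)) := {ω | ∃ c : Fin s → K, affinePoint c ω ∈ A} with hH
  have hNpos : 0 < N := by
    rw [hN]; exact_mod_cast Fintype.card_pos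
  have hWpos : 0 < W := by
    rw [hW]; exact_mod_cast Fintype.card_pos
  have hCcard : (Fintype.card (Fin s → K) : ℝ) = C := by simp [hC]
  let X : V × (Fin s → V) → ℝ := fun ω => ∑ c : Fin s → K, if affinePoint c ω ∈ A then 1 else 0
  have hone : ∀ c : Fin s → K,
      ∑ ω : V × (Fin s → V), (if affinePoint c ω ∈ A then (1 : ℝ) else 0) = #A / N * W := by
    intro c
    have h := card_preimage_mul_card (affinePoint (V := V) c).toAddMonoidHom
      (affinePoint_surjective c) A
    have h' : (#{ω : V × (Fin s → V) | affinePoint c ω ∈ A} : ℝ) * N = #A * W := by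
      simp only [LinearMap.toAddMonoidHom_coe] at h
      rw [hN, hW]
      exact_mod_cast h
    rw [sum_boole]
    field_simp
    linarith
  have htwo : ∀ c c' : Fin s → K, c ≠ c' →
      ∑ ω : V × (Fin s → V), (if affinePoint c ω ∈ A then (1 : ℝ) else 0) *
        (if affinePoint c' ω ∈ A then (1 : ℝ) else 0) = (#A / N) ^ 2 * W := by
    intro c c' hcc
    have h := card_preimage_mul_card
      ((affinePoint (V := V) c).prod (affinePoint c')).toAddMonoidHom
      (affinePoint_prod_surjective hcc) (A ×ˢ A)
    have h' : (#{ω : V × (Fin s → V) | affinePoint c ω ∈ A ∧ affinePoint c' ω ∈ A} : ℝ) * N ^ 2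
        = #A ^ 2 * W := by
      simp only [LinearMap.toAddMonoidHom_coe, LinearMap.prod_apply, Function.prod_apply,
        mem_product, card_product, Fintype.card_prod (α := V) (β := V)] at h
      rw [pow_two, pow_two, hN, hW]
      exact_mod_cast h
    have : ∀ ω : V × (Fin s → V), (if affinePoint c ω ∈ A then (1 : ℝ) else 0) *
        (if affinePoint c' ω ∈ A then (1 : ℝ) else 0)
        = if affinePoint c ω ∈ A ∧ affinePoint c' ω ∈ A then 1 else 0 := by
      intro ω
      by_cases h1 : affinePoint c ω ∈ A <;> by_cases h2 : affinePoint c' ω ∈ A <;> simp [h1, h2]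
    rw [sum_congr rfl (fun ω _ => this ω), sum_boole]
    field_simp
    linarith
  set l : ℝ := C * #A / N with hl
  have hl0 : 0 ≤ l := by positivity
  have hmean : ∑ ω, X ω = l * W := by
    simp only [X]
    rw [sum_comm, sum_congr rfl (fun c _ => hone c), sum_const, card_univ, nsmul_eq_mul, hCcard]
    simp only [hl]; ring
  have hsq : ∑ ω, X ω ^ 2 ≤ (l + l ^ 2) * W := by
    have hexp : ∑ ω, X ω ^ 2 = ∑ c : Fin s → K, ∑ c' : Fin s → K, ∑ ω : V × (Fin s → V),
        (if affinePoint c ω ∈ A then (1 : ℝ) else 0) *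
        (if affinePoint c' ω ∈ A then (1 : ℝ) else 0) := by
      simp only [X, pow_two, sum_mul_sum]
      rw [sum_comm]
      exact sum_congr rfl fun c _ => sum_comm
    have hterm : ∀ c c' : Fin s → K, ∑ ω : V × (Fin s → V),
        (if affinePoint c ω ∈ A then (1 : ℝ) else 0) *
        (if affinePoint c' ω ∈ A then (1 : ℝ) else 0)
        ≤ (if c = c' then #A / N * W else 0) + (#A / N) ^ 2 * W := by
      intro c c'
      by_cases hcc : c = c'
      · subst hcc
        have : ∀ ω : V × (Fin s → V), (if affinePoint c ω ∈ A then (1 : ℝ) else 0) *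
            (if affinePoint c ω ∈ A then (1 : ℝ) else 0)
            = if affinePoint c ω ∈ A then 1 else 0 := by
          intro ω; split_ifs <;> simp
        rw [sum_congr rfl (fun ω _ => this ω), hone, if_pos rfl]
        have : 0 ≤ (#A / N) ^ 2 * W := by positivity
        linarith
      · rw [htwo c c' hcc, if_neg hcc, zero_add]
    calc ∑ ω, X ω ^ 2 ≤ ∑ c : Fin s → K, ∑ c' : Fin s → K,
          ((if c = c' then #A / N * W else 0) + (#A / N) ^ 2 * W) := by
          rw [hexp]
          exact sum_le_sum fun c _ => sum_le_sum fun c' _ => hterm c c'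
      _ = (l + l ^ 2) * W := by
          simp only [sum_add_distrib, sum_ite_eq, mem_univ, if_true, sum_const, card_univ,
            nsmul_eq_mul, hCcard, hl]
          ring
  have hsupp : ∑ ω, X ω = ∑ ω, (if ω ∈ H then (1 : ℝ) else 0) * X ω := by
    refine sum_congr rfl fun ω _ => ?_
    by_cases hω : ω ∈ H
    · simp [hω]
    · rw [if_neg hω, zero_mul]
      refine sum_eq_zero fun c _ => if_neg fun hc => hω ?_
      simp only [hH, mem_filter, mem_univ, true_and]
      exact ⟨c, hc⟩
  have hcs : (∑ ω, X ω) ^ 2 ≤ #H * ∑ ω, X ω ^ 2 := by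
    rw [hsupp]
    refine (sum_mul_sq_le_sq_mul_sq univ _ _).trans (le_of_eq ?_)
    congr 1
    have : ∀ ω, (if ω ∈ H then (1 : ℝ) else 0) ^ 2 = if ω ∈ H then 1 else 0 := by
      intro ω; split_ifs <;> simp
    simp [this]
  have hH0 : (0 : ℝ) ≤ #H := Nat.cast_nonneg _
  rcases hl0.eq_or_lt with hz | hlpos
  · rw [← hz, min_eq_right zero_le_one, zero_mul]
    positivity
  have hkey : l * W ≤ #H * (1 + l) := by
    rw [hmean] at hcs
    have h1 : (l * W) ^ 2 ≤ #H * ((l + l ^ 2) * W) :=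
      hcs.trans (mul_le_mul_of_nonneg_left hsq hH0)
    have h2 : (l * W) * (l * W) ≤ (l * W) * (#H * (1 + l)) := by
      calc (l * W) * (l * W) = (l * W) ^ 2 := by ring
        _ ≤ _ := h1
        _ = _ := by ring
    exact le_of_mul_le_mul_left h2 (mul_pos hlpos hWpos)
  rcases le_total 1 l with h1 | h1
  · rw [min_eq_left h1]
    have : l * (1 * W) ≤ l * (2 * #H) := by nlinarith
    exact le_of_mul_le_mul_left this hlpos
  · rw [min_eq_right h1]
    nlinarith

/-- The parts of a partition of a linear matroid have rapidly decreasing sizes. -/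
lemma IsPartitionDatum.sum_min_density_le {P : Finset (Finset V)}
    (hP : IsPartitionDatum (fun T : Finset V =>
      LinearIndependent K (Subtype.val : {x // x ∈ T} → V)) P) (s : ℕ) :
    ∑ p ∈ P, min 1 ((Fintype.card K : ℝ) ^ s * #p / Fintype.card V) ≤ 2 * (s + 1) := by
  classical
  set W : ℝ := (Fintype.card (V × (Fin s → V)) : ℝ) with hW
  have hWpos : 0 < W := by
    rw [hW]; exact_mod_cast Fintype.card_pos
  have hhits : ∀ ω : V × (Fin s → V),
      #{p ∈ P | ∃ c : Fin s → K, affinePoint c ω ∈ p} ≤ s + 1 := by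
    intro ω
    have h := hP.card_parts_meeting_span_le (K := K) (Fin.cons ω.1 ω.2 : Fin (s + 1) → V)
      (filter_subset (fun p => ∃ c : Fin s → K, affinePoint c ω ∈ p) P)
      (by
        intro p hp
        obtain ⟨c, hc⟩ := (mem_filter.1 hp).2
        refine ⟨_, hc, ?_⟩
        rw [affinePoint_apply]
        refine Submodule.add_mem _ (Submodule.subset_span ⟨0, rfl⟩)
          (Submodule.sum_mem _ fun i _ => Submodule.smul_mem _ _
            (Submodule.subset_span ⟨i.succ, by simp⟩)))
    simpa using h
  have hswap : ∑ p ∈ P, #{ω : V × (Fin s → V) | ∃ c : Fin s → K, affinePoint c ω ∈ p}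
      = ∑ ω : V × (Fin s → V), #{p ∈ P | ∃ c : Fin s → K, affinePoint c ω ∈ p} := by
    simp only [card_filter]
    exact sum_comm
  have hnat : ∑ p ∈ P, #{ω : V × (Fin s → V) | ∃ c : Fin s → K, affinePoint c ω ∈ p}
      ≤ Fintype.card (V × (Fin s → V)) * (s + 1) := by
    rw [hswap]
    refine (sum_le_sum fun ω _ => hhits ω).trans (le_of_eq ?_)
    rw [sum_const, card_univ, smul_eq_mul]
  have hreal : ∑ p ∈ P, (#{ω : V × (Fin s → V) | ∃ c : Fin s → K, affinePoint c ω ∈ p} : ℝ)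
      ≤ W * (s + 1) := by
    rw [hW]
    exact_mod_cast hnat
  refine le_of_mul_le_mul_right ?_ hWpos
  calc (∑ p ∈ P, min 1 ((Fintype.card K : ℝ) ^ s * #p / Fintype.card V)) * W
      = ∑ p ∈ P, min 1 ((Fintype.card K : ℝ) ^ s * #p / Fintype.card V) * W := sum_mul _ _ _
    _ ≤ ∑ p ∈ P, 2 * (#{ω : V × (Fin s → V) | ∃ c : Fin s → K, affinePoint c ω ∈ p} : ℝ) :=
        sum_le_sum fun p _ => min_mul_card_le_two_mul_card_affine_hits s p
    _ ≤ 2 * (W * (s + 1)) := by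
        rw [← mul_sum]
        exact mul_le_mul_of_nonneg_left hreal zero_le_two
    _ = 2 * (s + 1) * W := by ring

/-- The images of a basis under all linear automorphisms meet, on average, few parts of a
partition of a linear matroid. -/
lemma IsPartitionDatum.sum_partitionWRank_le [Nontrivial V] [Fintype (V ≃ₗ[K] V)]
    {P : Finset (Finset V)}
    (hP : IsPartitionDatum (fun T : Finset V =>
      LinearIndependent K (Subtype.val : {x // x ∈ T} → V)) P)
    {d s : ℕ} (b : Module.Basis (Fin d) K V) (hds : d ≤ Fintype.card K ^ s) :
    ∑ g : V ≃ₗ[K] V, partitionWRank P (fun v => if ∃ j, g (b j) = v then 1 else 0) ≤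
      Fintype.card (V ≃ₗ[K] V) * (2 * (s + 1) / (1 - (Fintype.card V : ℝ)⁻¹)) := by
  set N : ℝ := (Fintype.card V : ℝ) with hN
  set G : ℝ := (Fintype.card (V ≃ₗ[K] V) : ℝ) with hG
  have hN1 : 1 < N := by
    rw [hN]; exact_mod_cast Fintype.one_lt_card
  have hN1' : 0 < 1 - N⁻¹ := by
    have := inv_lt_one_of_one_lt₀ hN1
    linarith
  have hN1'' : 1 - N⁻¹ ≤ 1 := by
    have : 0 ≤ N⁻¹ := by positivity
    linarith
  have hG0 : 0 ≤ G := Nat.cast_nonneg _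
  have hsup : ∀ (g : V ≃ₗ[K] V) (p : Finset V),
      sSup ((fun v => if ∃ j, g (b j) = v then (1 : ℝ) else 0) '' ↑p) ≤
        if ∃ j, g (b j) ∈ p then 1 else 0 := by
    intro g p
    refine Real.sSup_le ?_ (by split_ifs <;> norm_num)
    rintro _ ⟨v, hv, rfl⟩
    by_cases hvj : ∃ j, g (b j) = v
    · obtain ⟨j, rfl⟩ := hvj
      have hv' : ∃ j, g (b j) ∈ p := ⟨j, hv⟩
      simp [hv']
    · simp only [hvj, if_false]
      split_ifs <;> norm_num
  have hpart : ∀ p ∈ P, (∑ g : V ≃ₗ[K] V, if ∃ j, g (b j) ∈ p then (1 : ℝ) else 0) ≤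
      G * (min 1 ((Fintype.card K : ℝ) ^ s * #p / N) / (1 - N⁻¹)) := by
    intro p hp
    have hp0 := hP.zero_notMem hp
    have h1 : (∑ g : V ≃ₗ[K] V, if ∃ j, g (b j) ∈ p then (1 : ℝ) else 0) ≤ G := by
      refine (sum_le_sum (g := fun _ => (1 : ℝ)) fun g _ => ?_).trans (by simp [hG])
      split_ifs <;> norm_num
    have hj : ∀ j, (∑ g : V ≃ₗ[K] V, if g (b j) ∈ p then (1 : ℝ) else 0)
        = G * (#p / N / (1 - N⁻¹)) := by
      intro j
      have h := card_linearEquiv_apply_mem (K := K) (b.ne_zero j) hp0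
      have h' : (#{g : V ≃ₗ[K] V | g (b j) ∈ p} : ℝ) * (N - 1) = #p * G := by
        have : ((Fintype.card V - 1 : ℕ) : ℝ) = N - 1 := by
          rw [Nat.cast_sub Fintype.card_pos, hN, Nat.cast_one]
        rw [← this, hG]
        exact_mod_cast h
      rw [sum_boole]
      have hNe : N ≠ 0 := by positivity
      have hNe' : N - 1 ≠ 0 := by linarith
      have : N * (1 - N⁻¹) = N - 1 := by field_simp
      rw [div_div, this, ← mul_div_assoc, eq_div_iff hNe']
      linarith
    have h2 : (∑ g : V ≃ₗ[K] V, if ∃ j, g (b j) ∈ p then (1 : ℝ) else 0) ≤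
        G * (((Fintype.card K : ℝ) ^ s * #p / N) / (1 - N⁻¹)) := by
      calc (∑ g : V ≃ₗ[K] V, if ∃ j, g (b j) ∈ p then (1 : ℝ) else 0)
          ≤ ∑ g : V ≃ₗ[K] V, ∑ j, if g (b j) ∈ p then (1 : ℝ) else 0 := by
            refine sum_le_sum fun g _ => ?_
            have hnn : ∀ i ∈ (univ : Finset (Fin d)),
                (0 : ℝ) ≤ if g (b i) ∈ p then (1 : ℝ) else 0 := by
              intro i _; split_ifs <;> norm_num
            by_cases h : ∃ j, g (b j) ∈ p
            · obtain ⟨j, hj⟩ := h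
              rw [if_pos ⟨j, hj⟩]
              have := single_le_sum hnn (mem_univ j)
              rwa [if_pos hj] at this
            · rw [if_neg h]
              exact sum_nonneg hnn
        _ = d * (G * (#p / N / (1 - N⁻¹))) := by
            rw [sum_comm, sum_congr rfl (fun j _ => hj j)]
            simp
        _ ≤ (Fintype.card K : ℝ) ^ s * (G * (#p / N / (1 - N⁻¹))) := by
            refine mul_le_mul_of_nonneg_right (by exact_mod_cast hds) ?_
            positivity
        _ = _ := by ring
    rcases le_total 1 ((Fintype.card K : ℝ) ^ s * #p / N) with h | h
    · rw [min_eq_left h]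
      refine h1.trans (le_mul_of_one_le_right hG0 ?_)
      rw [le_div_iff₀ hN1']
      linarith
    · rw [min_eq_right h]
      exact h2
  calc ∑ g : V ≃ₗ[K] V, partitionWRank P (fun v => if ∃ j, g (b j) = v then 1 else 0)
      ≤ ∑ g : V ≃ₗ[K] V, ∑ p ∈ P, (if ∃ j, g (b j) ∈ p then (1 : ℝ) else 0) :=
        sum_le_sum fun g _ => sum_le_sum fun p _ => hsup g p
    _ = ∑ p ∈ P, ∑ g : V ≃ₗ[K] V, (if ∃ j, g (b j) ∈ p then (1 : ℝ) else 0) := sum_comm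
    _ ≤ ∑ p ∈ P, G * (min 1 ((Fintype.card K : ℝ) ^ s * #p / N) / (1 - N⁻¹)) :=
        sum_le_sum hpart
    _ = G * ((∑ p ∈ P, min 1 ((Fintype.card K : ℝ) ^ s * #p / N)) / (1 - N⁻¹)) := by
        rw [← mul_sum, sum_div]
    _ ≤ G * (2 * (s + 1) / (1 - N⁻¹)) := by
        have := hP.sum_min_density_le s
        gcongr

theorem HasPartitionProperty.mul_le [Nontrivial V] {d s : ℕ} (b : Module.Basis (Fin d) K V)
    (hds : d ≤ Fintype.card K ^ s) {α : ℝ}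
    (h : HasPartitionProperty (fun T : Finset V =>
      LinearIndependent K (Subtype.val : {x // x ∈ T} → V)) α) :
    α * d ≤ 2 * (s + 1) / (1 - (Fintype.card V : ℝ)⁻¹) := by
  obtain ⟨D, hD⟩ := h
  have : Finite (V ≃ₗ[K] V) := Finite.of_injective (fun g => (g : V → V)) DFunLike.coe_injective
  have := Fintype.ofFinite (V ≃ₗ[K] V)
  set B : ℝ := 2 * (s + 1) / (1 - (Fintype.card V : ℝ)⁻¹) with hB
  have hN1 : (1 : ℝ) < Fintype.card V := by exact_mod_cast Fintype.one_lt_card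
  have hB0 : 0 ≤ B := by
    have := inv_lt_one_of_one_lt₀ hN1
    have : 0 < 1 - (Fintype.card V : ℝ)⁻¹ := by linarith
    positivity
  rcases lt_or_ge α 0 with hα | hα
  · exact (mul_nonpos_of_nonpos_of_nonneg hα.le (Nat.cast_nonneg _)).trans hB0
  let w : (V ≃ₗ[K] V) → V → ℝ := fun g v => if ∃ j, g (b j) = v then 1 else 0
  have hw : ∀ g v, 0 ≤ w g v := by
    intro g v
    simp only [w]
    split_ifs <;> norm_num
  have hrank : ∀ g, ENNReal.ofReal (α * d) ≤
      ∑' P, D P * ENNReal.ofReal (partitionWRank (↑P) (w g)) := by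
    intro g
    refine le_trans (ENNReal.ofReal_le_ofReal ?_) (hD (w g) (hw g))
    refine mul_le_mul_of_nonneg_left ?_ hα
    have hbasis := card_le_maxIndepWeight_of_basis (b.map g)
    simp only [Module.Basis.map_apply] at hbasis
    exact hbasis
  have hnn : ∀ (P : Finset (Finset V)) g, 0 ≤ partitionWRank P (w g) := by
    intro P g
    refine sum_nonneg fun p _ => Real.sSup_nonneg ?_
    rintro _ ⟨v, -, rfl⟩
    exact hw g v
  have hG : (0 : ℝ) < Fintype.card (V ≃ₗ[K] V) := by exact_mod_cast Fintype.card_pos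
  have hsum : ENNReal.ofReal (Fintype.card (V ≃ₗ[K] V) * (α * d)) ≤
      ENNReal.ofReal (Fintype.card (V ≃ₗ[K] V) * B) := by
    calc ENNReal.ofReal (Fintype.card (V ≃ₗ[K] V) * (α * d))
        = ∑ g : V ≃ₗ[K] V, ENNReal.ofReal (α * d) := by
          rw [sum_const, card_univ, nsmul_eq_mul, ENNReal.ofReal_mul hG.le,
            ENNReal.ofReal_natCast]
      _ ≤ ∑ g : V ≃ₗ[K] V, ∑' P, D P * ENNReal.ofReal (partitionWRank (↑P) (w g)) :=
          sum_le_sum fun g _ => hrank g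
      _ = ∑' P, ∑ g : V ≃ₗ[K] V, D P * ENNReal.ofReal (partitionWRank (↑P) (w g)) :=
          (Summable.tsum_finsetSum fun _ _ => ENNReal.summable).symm
      _ ≤ ∑' P, D P * ENNReal.ofReal (Fintype.card (V ≃ₗ[K] V) * B) := by
          refine ENNReal.tsum_le_tsum fun P => ?_
          rw [← mul_sum, ← ENNReal.ofReal_sum_of_nonneg fun g _ => hnn P g]
          gcongr
          exact P.2.sum_partitionWRank_le b hds
      _ = ENNReal.ofReal (Fintype.card (V ≃ₗ[K] V) * B) := by
          rw [ENNReal.tsum_mul_right, PMF.tsum_coe, one_mul]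
  rw [ENNReal.ofReal_le_ofReal_iff (by positivity)] at hsum
  exact le_of_mul_le_mul_left hsum hG

end FiniteLinearAlgebra

lemma two_le_partition_constant : 2 ≤ 1.299 / (1 - 1 / Real.exp 1) := by
  have h1 : Real.exp 1 < 2.7182818286 := Real.exp_one_lt_d9
  have h2 : 2.7182818283 < Real.exp 1 := Real.exp_one_gt_d9
  have h3 : 0.36 < 1 / Real.exp 1 := by
    rw [lt_div_iff₀ (Real.exp_pos 1)]
    linarith
  have h4 : 1 / Real.exp 1 < 1 := by
    rw [div_lt_one (Real.exp_pos 1)]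
    linarith
  rw [le_div_iff₀ (by linarith)]
  linarith

/-- If `d ≤ q ^ s`, the partition constant of the full linear matroid over `F_q^d` is at most
`2 (s + 1) / (d (1 - q^{-d}))`. -/
theorem HasPartitionProperty.le_of_le_pow {d q s : ℕ} [Fact q.Prime] (hd : 0 < d)
    (hds : d ≤ q ^ s) {α t : ℝ}
    (h : HasPartitionProperty
        (fun T : Finset (Fin d → ZMod q) =>
          LinearIndependent (ZMod q) (Subtype.val : {x // x ∈ T} → (Fin d → ZMod q))) α)
    (hst : s + 1 ≤ t) :
    α ≤ (1.299 / (1 - 1 / Real.exp 1)) * (t / (d * (1 - ((q : ℝ) ^ d)⁻¹))) := by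
  have : NeZero d := ⟨hd.ne'⟩
  have hmul := h.mul_le (Pi.basisFun (ZMod q) (Fin d)) (s := s) (by rwa [ZMod.card])
  have hcard : (Fintype.card (Fin d → ZMod q) : ℝ) = (q : ℝ) ^ d := by simp [ZMod.card]
  rw [hcard] at hmul
  have hq : (1 : ℝ) < q := by exact_mod_cast (Fact.out : q.Prime).one_lt
  have hden : 0 < 1 - ((q : ℝ) ^ d)⁻¹ := by
    have := inv_lt_one_of_one_lt₀ (one_lt_pow₀ hq hd.ne')
    linarith
  have hd' : (0 : ℝ) < d := by exact_mod_cast hd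
  have hnum : 2 * ((s : ℝ) + 1) ≤ 1.299 / (1 - 1 / Real.exp 1) * t :=
    mul_le_mul two_le_partition_constant hst (by positivity)
      (zero_le_two.trans two_le_partition_constant)
  rw [le_div_iff₀ hden] at hmul
  rw [← mul_div_assoc, le_div_iff₀ (by positivity)]
  linarith

/-- (1) For `d > 2` and a prime `q ≥ d`: if the full linear matroid over `F_q^d`
(independent sets = linearly independent sets) satisfies the `α`-partition property,
then `α ≤ (1.299/(1 − 1/e))·3/(d·(1 − q^{−d}))`.
(2) For `d > 2`: if the full binary matroid over `F_2^d` satisfies the `α`-partition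
property, then `α ≤ (1.299/(1 − 1/e))·(3 + log₂ d)/(d·(1 − 2^{−d}))`. -/
theorem stmt18 :
    (∀ (d q : ℕ) [Fact q.Prime], 2 < d → d ≤ q → ∀ α : ℝ,
      HasPartitionProperty
        (fun T : Finset (Fin d → ZMod q) =>
          LinearIndependent (ZMod q) (Subtype.val : {x // x ∈ T} → (Fin d → ZMod q))) α →
      α ≤ (1.299 / (1 - 1 / Real.exp 1)) * (3 / (d * (1 - ((q : ℝ) ^ d)⁻¹)))) ∧
    (∀ d : ℕ, 2 < d → ∀ α : ℝ,
      HasPartitionProperty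
        (fun T : Finset (Fin d → ZMod 2) =>
          LinearIndependent (ZMod 2) (Subtype.val : {x // x ∈ T} → (Fin d → ZMod 2))) α →
      α ≤ (1.299 / (1 - 1 / Real.exp 1)) * ((3 + Real.logb 2 d) / (d * (1 - ((2 : ℝ) ^ d)⁻¹)))) := by
  refine ⟨?_, ?_⟩
  · intro d q _ hd hdq α h
    exact h.le_of_le_pow (s := 1) (by omega) (by simpa using hdq) (by norm_num)
  · intro d hd α h
    refine h.le_of_le_pow (q := 2) (s := Nat.clog 2 d) (by omega)
      (Nat.le_pow_clog one_lt_two d) ?_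
    have hlt : 2 ^ (Nat.clog 2 d - 1) < d := Nat.pow_pred_clog_lt_self one_lt_two (by omega)
    have hle : ((Nat.clog 2 d - 1 : ℕ) : ℝ) ≤ Real.logb 2 d := by
      rw [Real.le_logb_iff_rpow_le one_lt_two (by positivity), Real.rpow_natCast]
      exact_mod_cast hlt.le
    have hsub : (Nat.clog 2 d : ℝ) ≤ ((Nat.clog 2 d - 1 : ℕ) : ℝ) + 1 := by
      exact_mod_cast (by omega : Nat.clog 2 d ≤ Nat.clog 2 d - 1 + 1)
    linarith
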